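/- Let h be the measure f dσ on a planar facet F ⊂ R^3 (a triangle of diameter ≤ D), where f ∈ L²(F) and σ is the two-dimensional surface measure on F. Then for s > 1, ∫_{R^3} (1+|ξ|²)^{−s/2} |ĥ(ξ)|² dξ ≤ C(s, D) ∫_F |f|² dσ. -/

import Mathlib

open Metric Set MeasureTheory
open scoped RealInnerProductSpace

open scoped FourierTransform SchwartzMap in
/-- Plancherel's theorem for the integral Fourier transform of functions in `L¹ ∩ L²`. -/
theorem lintegral_enorm_fourier_sq {V : Type*} [NormedAddCommGroup V] [InnerProductSpace ℝ V]
    [FiniteDimensional ℝ V] [MeasurableSpace V] [BorelSpace V] {f : V → ℂ}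
    (hf : Integrable f) (hf2 : MemLp f 2) :
    ∫⁻ ξ, ‖𝓕 f ξ‖ₑ ^ 2 = ∫⁻ x, ‖f x‖ₑ ^ 2 := by
  have hae : (𝓕 (hf2.toLp f) : Lp ℂ 2 (volume : Measure V)) =ᵐ[volume] 𝓕 f := by
    apply ae_eq_of_integral_contDiff_smul_eq
    · exact (Lp.memLp _).locallyIntegrable (by norm_num)
    · exact (VectorFourier.fourierIntegral_continuous Real.continuous_fourierChar
        (L := innerₗ V) continuous_inner hf).locallyIntegrable
    intro g hg hgc
    let φ : 𝓢(V, ℂ) := HasCompactSupport.toSchwartzMap (f := fun x => (g x : ℂ))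
      (hgc.comp_left (g := ((↑) : ℝ → ℂ)) (by simp)) (Complex.ofRealCLM.contDiff.comp hg)
    have hφ : ∀ x, φ x = (g x : ℂ) := fun x => rfl
    have h1 := congrArg (fun T => T φ) (Lp.fourier_toTemperedDistribution_eq (hf2.toLp f))
    simp only [TemperedDistribution.fourier_apply, Lp.toTemperedDistribution_apply] at h1
    have h2 : ∫ ξ, 𝓕 (φ : V → ℂ) ξ • f ξ = ∫ x, φ x • 𝓕 f x := by
      simpa using! (VectorFourier.integral_fourierIntegral_smul_eq_flip (L := innerₗ V)
        Real.continuous_fourierChar continuous_inner φ.integrable hf)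
    have h3 : ∫ ξ, 𝓕 φ ξ • (hf2.toLp f) ξ = ∫ ξ, 𝓕 (φ : V → ℂ) ξ • f ξ := by
      refine integral_congr_ae ?_
      filter_upwards [hf2.coeFn_toLp] with x hx
      rw [hx, SchwartzMap.fourier_coe]
    have h4 := h1.symm.trans (h3.trans h2)
    simpa [hφ, Complex.real_smul] using h4
  have hn : ‖(𝓕 (hf2.toLp f) : Lp ℂ 2 (volume : Measure V))‖ₑ = ‖hf2.toLp f‖ₑ := by
    rw [enorm_eq_iff_norm_eq, Lp.norm_fourier_eq]
  rw [Lp.enorm_def, Lp.enorm_def, eLpNorm_congr_ae hae, eLpNorm_congr_ae hf2.coeFn_toLp] at hn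
  have key : ∀ u : V → ℂ, ∫⁻ x, ‖u x‖ₑ ^ 2 = eLpNorm u 2 volume ^ 2 := fun u => by
    simpa using (eLpNorm_nnreal_pow_eq_lintegral (p := 2) (f := u) (μ := volume) (by simp)).symm
  rw [key, key, hn]

open scoped FourierTransform in
/-- The `L²` extension estimate for a Haar measure on a Euclidean space. -/
theorem exists_lintegral_enorm_integral_exp_inner_sq_le {V : Type*} [NormedAddCommGroup V]
    [InnerProductSpace ℝ V] [FiniteDimensional ℝ V] [MeasurableSpace V] [BorelSpace V]
    (μ : Measure V) [μ.IsAddHaarMeasure] :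
    ∃ C : NNReal, ∀ g : V → ℂ, Integrable g μ → MemLp g 2 μ →
      ∫⁻ η, ‖∫ y, Complex.exp (Complex.I * (⟪y, η⟫ : ℂ)) * g y ∂μ‖ₑ ^ 2 ≤
        C * ∫⁻ y, ‖g y‖ₑ ^ 2 ∂μ := by
  obtain ⟨c, hc⟩ : ∃ c : NNReal, μ = c • (volume : Measure V) :=
    ⟨_, Measure.isAddLeftInvariant_eq_smul μ volume⟩
  obtain ⟨d, hd⟩ : ∃ d : NNReal, (volume : Measure V) = d • μ :=
    ⟨_, Measure.isAddLeftInvariant_eq_smul volume μ⟩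
  have hr : (-(2 * Real.pi)⁻¹) ≠ 0 := by simp [Real.pi_ne_zero]
  let b : NNReal := Real.toNNReal |((-(2 * Real.pi)⁻¹) ^ Module.finrank ℝ V)⁻¹|
  refine ⟨c ^ 2 * b * d, fun g hg hg2 => ?_⟩
  have hgv : Integrable g := hd ▸ hg.smul_measure_nnreal
  have hg2v : MemLp g 2 := hd ▸ hg2.smul_measure ENNReal.coe_ne_top
  have hG : ∀ η : V, ‖∫ y, Complex.exp (Complex.I * (⟪y, η⟫ : ℂ)) * g y ∂μ‖ₑ ^ 2 =
      (c : ENNReal) ^ 2 * ‖𝓕 g ((-(2 * Real.pi)⁻¹) • η)‖ₑ ^ 2 := by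
    intro η
    have : ∫ y, Complex.exp (Complex.I * (⟪y, η⟫ : ℂ)) * g y ∂μ =
        (c : ℂ) * 𝓕 g ((-(2 * Real.pi)⁻¹) • η) := by
      rw [hc, integral_smul_nnreal_measure, Real.fourier_eq', NNReal.smul_def,
        Complex.real_smul]
      congr 1
      refine integral_congr_ae (.of_forall fun y => ?_)
      simp only [smul_eq_mul, inner_smul_right]
      congr 2
      push_cast
      field_simp
    rw [this, enorm_mul, mul_pow]
    congr 2
    simp [enorm_eq_nnnorm]
  have hm : ∫⁻ η : V, ‖𝓕 g ((-(2 * Real.pi)⁻¹) • η)‖ₑ ^ 2 = b * ∫⁻ η, ‖𝓕 g η‖ₑ ^ 2 := by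
    have he := (Homeomorph.smulOfNeZero _ hr (α := V)).measurableEmbedding.lintegral_map
      (μ := volume) (fun η => ‖𝓕 g η‖ₑ ^ 2)
    simp only [Homeomorph.smulOfNeZero_apply] at he
    rw [← he]
    change ∫⁻ a, _ ∂(Measure.map (fun η : V => (-(2 * Real.pi)⁻¹) • η) volume) = _
    rw [Measure.map_addHaar_smul _ hr, lintegral_smul_measure]
    rfl
  simp_rw [hG]
  rw [lintegral_const_mul' _ _ (by simp), hm, lintegral_enorm_fourier_sq hgv hg2v]
  conv_lhs => rw [hd]
  simp only [lintegral_smul_measure]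
  rw [ENNReal.smul_def, smul_eq_mul]
  push_cast
  simp only [mul_assoc]
  exact le_rfl

/-- A plane triangle in space lies in the image of a coordinate plane under a rigid motion. -/
theorem exists_linearIsometryEquiv_convexHull (P : Fin 3 → EuclideanSpace ℝ (Fin 3)) :
    ∃ Φ : WithLp 2 (EuclideanSpace ℝ (Fin 2) × ℝ) ≃ₗᵢ[ℝ] EuclideanSpace ℝ (Fin 3),
      ∀ x ∈ convexHull ℝ (range P), ∃ y, P 0 + Φ (WithLp.toLp 2 (y, 0)) = x := by
  let Φ₀ : WithLp 2 (EuclideanSpace ℝ (Fin 2) × ℝ) ≃ₗᵢ[ℝ] EuclideanSpace ℝ (Fin 3) :=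
    ((stdOrthonormalBasis ℝ _).reindex (finCongr (by
      rw [(WithLp.linearEquiv 2 ℝ (EuclideanSpace ℝ (Fin 2) × ℝ)).finrank_eq]; simp))).repr
  obtain ⟨n, hn, hnP⟩ : ∃ n : EuclideanSpace ℝ (Fin 3), ‖n‖ = 1 ∧
      ∀ i, ⟪P i - P 0, n⟫ = 0 := by
    let K : Submodule ℝ (EuclideanSpace ℝ (Fin 3)) :=
      Submodule.span ℝ (range ![P 1 - P 0, P 2 - P 0])
    have hK : Kᗮ ≠ ⊥ := by
      rw [Ne, Submodule.orthogonal_eq_bot_iff]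
      intro h
      have h1 : Module.finrank ℝ K ≤ 2 := finrank_range_le_card _
      rw [h] at h1
      simp at h1
    obtain ⟨v, hv, hv0⟩ := Submodule.exists_mem_ne_zero_of_ne_bot hK
    have hvP : ∀ i, ⟪P i - P 0, v⟫ = 0 := by
      intro i
      fin_cases i
      · simp
      · exact hv _ (Submodule.subset_span (by simp))
      · exact hv _ (Submodule.subset_span (by simp))
    refine ⟨‖v‖⁻¹ • v, norm_smul_inv_norm hv0, fun i => ?_⟩
    rw [inner_smul_right, hvP, mul_zero]
  have he : ‖Φ₀ (WithLp.toLp 2 (0, 1))‖ = ‖n‖ := by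
    rw [LinearIsometryEquiv.norm_map, hn, WithLp.prod_norm_eq_of_L2]
    simp
  let Φ := Φ₀.trans (Submodule.reflection (ℝ ∙ (Φ₀ (WithLp.toLp 2 (0, 1)) - n))ᗮ)
  have hΦ : Φ (WithLp.toLp 2 (0, 1)) = n := Submodule.reflection_sub he
  refine ⟨Φ, fun x hx => ?_⟩
  have hxn : ⟪x - P 0, n⟫ = 0 := by
    have hsub : convexHull ℝ (range P) ⊆ {x | ⟪n, x⟫ = ⟪n, P 0⟫} := by
      refine convexHull_min ?_ (convex_hyperplane (innerₛₗ ℝ n).isLinear _)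
      rintro _ ⟨i, rfl⟩
      have := hnP i
      rw [inner_sub_left, real_inner_comm, real_inner_comm n (P 0)] at this
      exact sub_eq_zero.1 this
    have := hsub hx
    rw [real_inner_comm, inner_sub_right]
    exact sub_eq_zero.2 this
  have ht : (Φ.symm (x - P 0)).snd = 0 := by
    rw [← hΦ, ← Φ.apply_symm_apply (x - P 0), Φ.inner_map_map, WithLp.prod_inner_apply] at hxn
    simpa using hxn
  refine ⟨(Φ.symm (x - P 0)).fst, ?_⟩
  have : WithLp.toLp 2 ((Φ.symm (x - P 0)).fst, 0) = Φ.symm (x - P 0) := by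
    rw [← ht]; rfl
  rw [this, Φ.apply_symm_apply, add_sub_cancel]

/-- Let `h = f dσ` on a planar facet `F ⊂ ℝ³` (a triangle of diameter ≤ `D`), where
`f ∈ L²(F, σ)` and `σ` is the two-dimensional surface (Hausdorff) measure on `F`. Then for
`s > 1`, `∫_{ℝ³} (1+|ξ|²)^{−s/2} |ĥ(ξ)|² dξ ≤ C(s, D) ∫_F |f|² dσ`. -/
theorem stmt19 (s D : ℝ) (hs : 1 < s) (hD : 0 < D) :
    ∃ C : ℝ, 0 < C ∧
      ∀ (P : Fin 3 → EuclideanSpace ℝ (Fin 3)) (f : EuclideanSpace ℝ (Fin 3) → ℂ),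
        Metric.diam (convexHull ℝ (Set.range P)) ≤ D →
        Integrable f (μH[2].restrict (convexHull ℝ (Set.range P))) →
        Integrable (fun x => ‖f x‖ ^ 2) (μH[2].restrict (convexHull ℝ (Set.range P))) →
        ∫⁻ ξ : EuclideanSpace ℝ (Fin 3),
            ENNReal.ofReal ((1 + ‖ξ‖ ^ 2) ^ (-(s / 2)) *
              ‖∫ x in convexHull ℝ (Set.range P),
                  Complex.exp (Complex.I * (↑(⟪x, ξ⟫) : ℂ)) * f x ∂μH[2]‖ ^ 2) ≤
          ENNReal.ofReal (C * ∫ x in convexHull ℝ (Set.range P), ‖f x‖ ^ 2 ∂μH[2]) := by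
  have : (μH[2] : Measure (EuclideanSpace ℝ (Fin 2))).IsAddHaarMeasure := by
    simpa using isAddHaarMeasure_hausdorffMeasure (E := EuclideanSpace ℝ (Fin 2))
  obtain ⟨C₂, hC₂⟩ := exists_lintegral_enorm_integral_exp_inner_sq_le
    (μH[2] : Measure (EuclideanSpace ℝ (Fin 2)))
  have hwi : Integrable (fun t : ℝ => (1 + t ^ 2) ^ (-(s / 2))) := by
    simpa [neg_div] using
      integrable_rpow_neg_one_add_norm_sq (E := ℝ) (μ := volume) (r := s) (by simpa using hs)
  set K : ENNReal := ∫⁻ t : ℝ, ENNReal.ofReal ((1 + t ^ 2) ^ (-(s / 2)))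
  have hKt : K ≠ ⊤ := hwi.lintegral_lt_top.ne
  refine ⟨(K * C₂).toReal + 1, by positivity, fun P f _ hf hf2 => ?_⟩
  obtain ⟨Φ, hΦ⟩ := exists_linearIsometryEquiv_convexHull P
  set F := convexHull ℝ (range P)
  have hF : MeasurableSet F := ((finite_range P).isCompact_convexHull ℝ).measurableSet
  let J : EuclideanSpace ℝ (Fin 2) → EuclideanSpace ℝ (Fin 3) :=
    fun y => P 0 + Φ (WithLp.toLp 2 (y, 0))
  have hJ : Isometry J := by
    refine Isometry.of_dist_eq fun y z => ?_
    rw [dist_add_left, Φ.dist_map, WithLp.prod_dist_eq_of_L2]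
    simp
  have hJe : MeasurableEmbedding J := hJ.isClosedEmbedding.measurableEmbedding
  set A := J ⁻¹' F
  have hA : MeasurableSet A := hJe.measurable hF
  have hμ : (μH[2] : Measure (EuclideanSpace ℝ (Fin 3))).restrict F =
      (μH[2].restrict A).map J := by
    rw [← Measure.restrict_map hJe.measurable hF, hJ.map_hausdorffMeasure (by simp),
      Measure.restrict_restrict_of_subset (show F ⊆ range J from hΦ)]
  have hfm : MemLp f 2 (μH[2].restrict F) := (memLp_two_iff_integrable_sq_norm hf.1).2 hf2
  have hnorm : ENNReal.ofReal (∫ x in F, ‖f x‖ ^ 2 ∂μH[2]) = ∫⁻ x in F, ‖f x‖ₑ ^ 2 ∂μH[2] := by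
    rw [ofReal_integral_eq_lintegral_ofReal hf2 (.of_forall fun _ => by positivity)]
    simp [ENNReal.ofReal_pow]
  rw [ENNReal.ofReal_mul (by positivity), hnorm]
  rw [hμ] at hf hfm ⊢
  rw [hJe.integrable_map_iff] at hf
  rw [hJe.memLp_map_measure_iff] at hfm
  rw [hJe.lintegral_map]
  set g := A.indicator (f ∘ J) with hg
  have hgi : Integrable g μH[2] := (integrable_indicator_iff hA).2 hf
  have hgm : MemLp g 2 μH[2] := (memLp_indicator_iff_restrict hA).2 hfm
  have hgn : ∫⁻ y in A, ‖f (J y)‖ₑ ^ 2 ∂μH[2] = ∫⁻ y, ‖g y‖ₑ ^ 2 ∂μH[2] := by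
    rw [← lintegral_indicator hA]
    refine lintegral_congr fun y => ?_
    by_cases hy : y ∈ A <;> simp [hg, hy]
  rw [hgn]
  let G : EuclideanSpace ℝ (Fin 2) → ℂ :=
    fun η => ∫ y, Complex.exp (Complex.I * (⟪y, η⟫ : ℂ)) * g y ∂μH[2]
  have hG : ∀ η t, ‖∫ x, Complex.exp (Complex.I * (⟪x, Φ (WithLp.toLp 2 (η, t))⟫ : ℂ)) * f x
      ∂((μH[2].restrict A).map J)‖ = ‖G η‖ := by
    intro η t
    rw [hJe.integral_map, ← integral_indicator hA]
    have : ∀ y, A.indicator (fun y => Complex.exp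
        (Complex.I * (⟪J y, Φ (WithLp.toLp 2 (η, t))⟫ : ℂ)) * f (J y)) y =
        Complex.exp (Complex.I * (⟪P 0, Φ (WithLp.toLp 2 (η, t))⟫ : ℂ)) *
          (Complex.exp (Complex.I * (⟪y, η⟫ : ℂ)) * g y) := by
      intro y
      by_cases hy : y ∈ A
      · simp only [hg, indicator_of_mem hy, Function.comp_apply, J, inner_add_left,
          Φ.inner_map_map, WithLp.prod_inner_apply]
        rw [← mul_assoc, ← Complex.exp_add]
        simp [mul_add]
      · simp [hg, hy]
    simp_rw [this]
    rw [integral_const_mul, norm_mul, mul_comm Complex.I, Complex.norm_exp_ofReal_mul_I, one_mul]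
  have hΨ : MeasurePreserving (fun p : EuclideanSpace ℝ (Fin 2) × ℝ => Φ (WithLp.toLp 2 p)) :=
    Φ.measurePreserving.comp (WithLp.volume_preserving_toLp _ _)
  have hΨe : MeasurableEmbedding
      (fun p : EuclideanSpace ℝ (Fin 2) × ℝ => Φ (WithLp.toLp 2 p)) :=
    Φ.toMeasurableEquiv.measurableEmbedding.comp
      (MeasurableEquiv.toLp 2 (EuclideanSpace ℝ (Fin 2) × ℝ)).measurableEmbedding
  rw [← hΨ.lintegral_comp_emb hΨe]
  calc
    _ ≤ ∫⁻ p : EuclideanSpace ℝ (Fin 2) × ℝ,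
        ENNReal.ofReal ((1 + p.2 ^ 2) ^ (-(s / 2))) * ‖G p.1‖ₑ ^ 2 := by
      refine lintegral_mono fun p => ?_
      rw [hG, ENNReal.ofReal_mul (by positivity), ENNReal.ofReal_pow (norm_nonneg _),
        ofReal_norm]
      gcongr ENNReal.ofReal ?_ * _
      refine Real.rpow_le_rpow_of_nonpos (by positivity) ?_ (by linarith)
      rw [Φ.norm_map, WithLp.prod_norm_sq_eq_of_L2]
      simp
    _ ≤ ∫⁻ η, ∫⁻ t, ENNReal.ofReal ((1 + t ^ 2) ^ (-(s / 2))) * ‖G η‖ₑ ^ 2 :=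
      lintegral_prod_le _
    _ = K * ∫⁻ η, ‖G η‖ₑ ^ 2 := by
      simp_rw [lintegral_mul_const' _ _ (ENNReal.pow_ne_top enorm_ne_top)]
      exact lintegral_const_mul' _ _ hKt
    _ ≤ K * (C₂ * ∫⁻ y, ‖g y‖ₑ ^ 2 ∂μH[2]) := by
      gcongr
      exact hC₂ g hgi hgm
    _ ≤ _ := by
      rw [← mul_assoc]
      gcongr
      exact (ENNReal.ofReal_toReal (ENNReal.mul_ne_top hKt ENNReal.coe_ne_top)).symm.le.trans
        (ENNReal.ofReal_le_ofReal (by linarith))
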